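/- The class K₀ has the joint embedding property: for all B₁, B₂ in K₀ there exist C in K₀ and embeddings g₁ : B₁ → C and g₂ : B₂ → C. -/

import Mathlib

open FirstOrder FirstOrder.Language

/-- The relation symbols of the language `L₀`: for each `n ≥ 3`,
a symbol `Eₙ` of arity `2 * n`. -/
inductive L0Rel : ℕ → Type
  | E (n : ℕ) (hn : 3 ≤ n) : L0Rel (2 * n)

/-- The language `L₀`, with one relation symbol `Eₙ` of arity `2n` for each `n ≥ 3`,
and no function symbols. -/
def L0 : FirstOrder.Language :=
  { Functions := fun _ => Empty
    Relations := L0Rel }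

/-- The interpretation of `Eₙ` as a binary relation on `n`-tuples:
`ERel n hn x y` holds iff `Eₙ(x̄, ȳ)` holds of the concatenated `2n`-tuple. -/
def ERel {M : Type*} [L0.Structure M] (n : ℕ) (hn : 3 ≤ n) (x y : Fin n → M) : Prop :=
  Structure.RelMap (L := L0) (L0Rel.E n hn) (Fin.append x y ∘ Fin.cast (two_mul n))

/-- Membership in the class `K₀`: a finite `L₀`-structure in which,
for each `n ≥ 3`, `Eₙ` holds only on `2n`-tuples whose halves each consist of `n`
pairwise distinct elements, is invariant under separately permuting the entries of the
two halves, induces an equivalence relation on the `n`-element subsets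
(reflexivity on injective tuples, symmetry and transitivity), and is empty when
`n` exceeds the cardinality of the structure. -/
def MemK0 (A : Type*) [L0.Structure A] : Prop :=
  Finite A ∧ ∀ (n : ℕ) (hn : 3 ≤ n),
    (∀ x y : Fin n → A, ERel n hn x y → Function.Injective x ∧ Function.Injective y) ∧
    (∀ (x y : Fin n → A) (σ τ : Equiv.Perm (Fin n)),
      ERel n hn x y → ERel n hn (x ∘ σ) (y ∘ τ)) ∧
    (∀ x : Fin n → A, Function.Injective x → ERel n hn x x) ∧
    (∀ x y : Fin n → A, ERel n hn x y → ERel n hn y x) ∧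
    (∀ x y z : Fin n → A, ERel n hn x y → ERel n hn y z → ERel n hn x z) ∧
    (n > Nat.card A → ∀ x y : Fin n → A, ¬ ERel n hn x y)

/-- The `L₀`-structure in which each `Eₙ` is interpreted as a given relation on pairs of
`n`-tuples. -/
@[reducible]
def L0.ofRel {M : Type*} (R : ∀ n : ℕ, (Fin n → M) → (Fin n → M) → Prop) : L0.Structure M where
  funMap f := Empty.elim f
  RelMap
    | L0Rel.E n _, v =>
      R n (fun i => v ((Fin.castAdd n i).cast (two_mul n).symm))
        (fun i => v ((Fin.natAdd n i).cast (two_mul n).symm))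

theorem ERel_ofRel {M : Type*} (R : ∀ n : ℕ, (Fin n → M) → (Fin n → M) → Prop)
    (n : ℕ) (hn : 3 ≤ n) (x y : Fin n → M) :
    @ERel M (L0.ofRel R) n hn x y ↔ R n x y := by
  change R n (fun i => Fin.append x y (Fin.castAdd n i))
    (fun i => Fin.append x y (Fin.natAdd n i)) ↔ R n x y
  simp only [Fin.append_left, Fin.append_right]

theorem relMap_E_iff_ERel {M : Type*} [L0.Structure M] (n : ℕ) (hn : 3 ≤ n)
    (v : Fin (2 * n) → M) :
    Structure.RelMap (L := L0) (L0Rel.E n hn) v ↔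
      ERel n hn (fun i => v ((Fin.castAdd n i).cast (two_mul n).symm))
        (fun i => v ((Fin.natAdd n i).cast (two_mul n).symm)) := by
  have h : Fin.append (fun i => v ((Fin.castAdd n i).cast (two_mul n).symm))
      (fun i => v ((Fin.natAdd n i).cast (two_mul n).symm)) =
      v ∘ Fin.cast (two_mul n).symm := by
    funext i
    refine Fin.addCases (fun j => ?_) (fun j => ?_) i
    · rw [Fin.append_left]; rfl
    · rw [Fin.append_right]; rfl
  rw [ERel, h]
  rfl

/-- An injection preserving and reflecting `ERel` is an embedding of `L₀`-structures. -/
def L0.embeddingOfERel {M N : Type*} [L0.Structure M] [L0.Structure N] (f : M ↪ N)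
    (hf : ∀ (n : ℕ) (hn : 3 ≤ n) (x y : Fin n → M),
      ERel n hn (f ∘ x) (f ∘ y) ↔ ERel n hn x y) : M ↪[L0] N where
  toEmbedding := f
  map_fun' g := Empty.elim g
  map_rel' := by
    rintro _ ⟨n, hn⟩ v
    exact (relMap_E_iff_ERel n hn _).trans
      ((hf n hn _ _).trans (relMap_E_iff_ERel n hn v).symm)

/-- The relation on `n`-tuples of a disjoint union that extends the relations `Eₙ` of the
summands by making every other `n`-element set equivalent only to itself. -/
def sigmaRel {ι : Type*} (B : ι → Type*) [∀ i, L0.Structure (B i)] (n : ℕ)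
    (x y : Fin n → Σ i, B i) : Prop :=
  (Function.Injective x ∧ ∃ σ : Equiv.Perm (Fin n), y = x ∘ σ) ∨
    ∃ (hn : 3 ≤ n) (i : ι) (x' y' : Fin n → B i),
      ERel n hn x' y' ∧ x = Sigma.mk i ∘ x' ∧ y = Sigma.mk i ∘ y'

theorem sigmaMk_comp_inj {ι α : Type*} {B : ι → Type*} [Nonempty α] {i j : ι} {x : α → B i}
    {y : α → B j} (h : (Sigma.mk i ∘ x : α → Σ i, B i) = Sigma.mk j ∘ y) :
    ∃ e : i = j, e ▸ x = y := by
  obtain ⟨a⟩ := ‹Nonempty α›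
  obtain rfl : i = j := congrArg Sigma.fst (congrFun h a)
  exact ⟨rfl, sigma_mk_injective.comp_left h⟩

section

variable {ι : Type*} {B : ι → Type*} [∀ i, L0.Structure (B i)]

theorem sigmaRel_mk_comp (hB : ∀ i, MemK0 (B i)) {n : ℕ} (hn : 3 ≤ n) {i : ι}
    (x y : Fin n → B i) :
    sigmaRel B n (Sigma.mk i ∘ x) (Sigma.mk i ∘ y) ↔ ERel n hn x y := by
  have : NeZero n := ⟨by omega⟩
  refine ⟨?_, fun h => Or.inr ⟨hn, i, x, y, h, rfl, rfl⟩⟩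
  obtain ⟨-, hperm, hrefl, -⟩ := (hB i).2 n hn
  rintro (⟨hx, σ, hσ⟩ | ⟨_, j, x', y', h, hx, hy⟩)
  · obtain rfl : y = x ∘ σ := sigma_mk_injective.comp_left hσ
    exact hperm x x 1 σ (hrefl x hx.of_comp)
  · obtain ⟨rfl, rfl⟩ := sigmaMk_comp_inj hx
    obtain ⟨_, rfl⟩ := sigmaMk_comp_inj hy
    exact h

theorem sigmaRel_injective (hB : ∀ i, MemK0 (B i)) {n : ℕ} {x y : Fin n → Σ i, B i}
    (h : sigmaRel B n x y) : Function.Injective x ∧ Function.Injective y := by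
  rcases h with ⟨hx, σ, rfl⟩ | ⟨hn, i, x', y', h, rfl, rfl⟩
  · exact ⟨hx, hx.comp σ.injective⟩
  · obtain ⟨hx, hy⟩ := ((hB i).2 n hn).1 x' y' h
    exact ⟨sigma_mk_injective.comp hx, sigma_mk_injective.comp hy⟩

theorem sigmaRel_perm (hB : ∀ i, MemK0 (B i)) {n : ℕ} {x y : Fin n → Σ i, B i}
    (σ τ : Equiv.Perm (Fin n)) (h : sigmaRel B n x y) : sigmaRel B n (x ∘ σ) (y ∘ τ) := by
  rcases h with ⟨hx, ρ, rfl⟩ | ⟨hn, i, x', y', h, rfl, rfl⟩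
  · exact Or.inl ⟨hx.comp σ.injective, σ⁻¹ * ρ * τ, by ext1 k; simp⟩
  · exact Or.inr ⟨hn, i, x' ∘ σ, y' ∘ τ, ((hB i).2 n hn).2.1 x' y' σ τ h, rfl, rfl⟩

theorem sigmaRel_symm (hB : ∀ i, MemK0 (B i)) {n : ℕ} {x y : Fin n → Σ i, B i}
    (h : sigmaRel B n x y) : sigmaRel B n y x := by
  rcases h with ⟨hx, σ, rfl⟩ | ⟨hn, i, x', y', h, rfl, rfl⟩
  · exact Or.inl ⟨hx.comp σ.injective, σ⁻¹, by ext1 k; simp⟩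
  · exact Or.inr ⟨hn, i, y', x', ((hB i).2 n hn).2.2.2.1 x' y' h, rfl, rfl⟩

theorem sigmaRel_trans (hB : ∀ i, MemK0 (B i)) {n : ℕ} {x y z : Fin n → Σ i, B i}
    (hxy : sigmaRel B n x y) (hyz : sigmaRel B n y z) : sigmaRel B n x z := by
  rcases hyz with ⟨-, σ, rfl⟩ | ⟨hn, i, y', z', hyz, rfl, rfl⟩
  · exact sigmaRel_perm hB 1 σ hxy
  rcases hxy with ⟨-, σ, hσ⟩ | ⟨_, j, x', y'', hxy, rfl, hy⟩
  · obtain rfl : x = Sigma.mk i ∘ y' ∘ ⇑σ⁻¹ := by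
      rw [← Function.comp_assoc, hσ]
      ext1 k
      simp
    exact sigmaRel_perm hB σ⁻¹ 1 (Or.inr ⟨hn, i, y', z', hyz, rfl, rfl⟩)
  · have : NeZero n := ⟨by omega⟩
    obtain ⟨rfl, rfl⟩ := sigmaMk_comp_inj hy
    exact Or.inr ⟨hn, i, x', z', ((hB i).2 n hn).2.2.2.2.1 x' y' z' hxy hyz, rfl, rfl⟩

theorem memK0_sigma [Finite ι] (hB : ∀ i, MemK0 (B i)) :
    @MemK0 (Σ i, B i) (L0.ofRel (sigmaRel B)) := by
  have := fun i => (hB i).1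
  refine ⟨inferInstance, fun n hn => ?_⟩
  simp only [ERel_ofRel]
  refine ⟨fun x y => sigmaRel_injective hB, fun x y σ τ => sigmaRel_perm hB σ τ,
    fun x hx => Or.inl ⟨hx, 1, rfl⟩, fun x y => sigmaRel_symm hB,
    fun x y z => sigmaRel_trans hB, fun hcard x y h => ?_⟩
  have := Nat.card_le_card_of_injective x (sigmaRel_injective hB h).1
  rw [Nat.card_fin] at this
  omega

end

/-- The class `K₀` has the joint embedding property. -/
theorem K0_jointEmbedding (B₁ B₂ : CategoryTheory.Bundled.{0} L0.Structure)
    (hB₁ : MemK0 B₁) (hB₂ : MemK0 B₂) :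
    ∃ (C : CategoryTheory.Bundled.{0} L0.Structure) (_g₁ : B₁ ↪[L0] C) (_g₂ : B₂ ↪[L0] C),
      MemK0 C := by
  let B : Bool → CategoryTheory.Bundled.{0} L0.Structure := fun b => cond b B₁ B₂
  have hB : ∀ b, MemK0 (B b) := Bool.rec hB₂ hB₁
  let _ : L0.Structure (Σ b, B b) := L0.ofRel (sigmaRel fun b => B b)
  have emb (b : Bool) : B b ↪[L0] (Σ b, B b) :=
    L0.embeddingOfERel (Function.Embedding.sigmaMk (β := fun b => B b) b) fun n hn x y =>
      (ERel_ofRel (sigmaRel fun b => B b) n hn (Sigma.mk b ∘ x) (Sigma.mk b ∘ y)).trans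
        (sigmaRel_mk_comp hB hn x y)
  exact ⟨⟨Σ b, B b, inferInstance⟩, emb true, emb false, memK0_sigma hB⟩
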